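/- Let (U_n)_{n≥0} be the VLMC defined by a probabilized infinite comb with q_{0^∞}(0) = 1, and assume the series ∑_{n≥0} c_n converges, with sum S(1). Then there is a one-parameter family of stationary probability measures on L: for every a ∈ [0,1] there exists a unique stationary probability measure π_a on L with π_a(0^∞) = a; it is characterized by π_a(1) = (1−a)/S(1), π_a(10^n) = π_a(1)·c_n, π_a(0^n) = 1 − π_a(1)·∑_{k=0}^{n−1} c_k, and the product formula for stationary probabilities of cylinders. Furthermore, π_a is nontrivial except in exactly two cases: a = 1, where π_1(0^∞) = 1; and a = 0 with q_1(0) = 0, where π_0(1^∞) = 1. -/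

import Mathlib

open MeasureTheory
open ProbabilityTheory (Kernel IsMarkovKernel)
open scoped ENNReal

namespace VLMC

/-- Left-infinite sequences over the alphabet `{0,1}`; `s 0` is the rightmost
(most recent) letter, `s 1` the one before it, etc. -/
abbrev L : Type := ℕ → Bool

/-- Append the letter `b` on the right of the left-infinite sequence `s`. -/
def extend (b : Bool) (s : L) : L := fun n => match n with
  | 0 => b
  | k + 1 => s k

/-- Sequences whose letters, read from the rightmost one leftwards, start with `u`. -/
def cylRev (u : List Bool) : Set L := {s | ∀ i < u.length, s i = u.getD i false}

/-- The cylinder `Lw` of left-infinite sequences admitting the finite word `w` as a suffix. -/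
def cyl (w : List Bool) : Set L := cylRev w.reverse

/-- `π` is a stationary (invariant) probability measure for the kernel `κ`. -/
def IsStationary (κ : Kernel L L) (π : Measure L) : Prop :=
  ∀ B : Set L, MeasurableSet B → π B = ∫⁻ s, κ s B ∂π

/-- `cₙ = ∏_{k=0}^{n-1} q_{0ᵏ1}(0)` (with `c₀ = 1`), for the infinite comb. -/
noncomputable def combC (q : ℕ → Bool → ℝ≥0∞) (n : ℕ) : ℝ≥0∞ :=
  ∏ k ∈ Finset.range n, q k false

/-- The left-infinite sequence `0^∞`. -/
def zeroSeq : L := fun _ => false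

/-- `κ` is the transition kernel of the VLMC associated with the probabilized
infinite comb whose contexts are the words `0ⁿ1`, `n ≥ 0` (with probability
measures `q n` on the alphabet) and the infinite word `0^∞` (with probability
measure `qinf`) : from a state with context `0ⁿ1` (i.e. ending with `10ⁿ`),
a letter `α` is appended on the right with probability `q n α`, and from the
state `0^∞` with probability `qinf α`. -/
def IsCombKernel (q : ℕ → Bool → ℝ≥0∞) (qinf : Bool → ℝ≥0∞) (κ : Kernel L L) : Prop :=
  (∀ (n : ℕ) (s : L), s ∈ cylRev (List.replicate n false ++ [true]) →
      κ s = q n false • Measure.dirac (extend false s)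
          + q n true • Measure.dirac (extend true s)) ∧
  κ zeroSeq = qinf false • Measure.dirac (extend false zeroSeq)
            + qinf true • Measure.dirac (extend true zeroSeq)

attribute [local instance] Classical.propDecidable

/-- The one-step conditional probability `q_{pref(w)}(b)` for the infinite comb :
if `w̄ = 0ᵏ` is an internal node (i.e. `w` contains no `1`), it is `π(wb)/π(w)`
(and `0` if `π(w) = 0`); otherwise `pref(w) = 0ᵐ1` where `m` is the number of
trailing zeros of `w`, and it is `q m b`. -/
noncomputable def combQstep (q : ℕ → Bool → ℝ≥0∞) (π : Measure L)
    (w : List Bool) (b : Bool) : ℝ≥0∞ :=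
  if w.all (fun x => !x) then
    (if π (cyl w) = 0 then 0 else π (cyl (w ++ [b])) / π (cyl w))
  else q (w.reverse.takeWhile (fun x => !x)).length b

section Cylinders

lemma cylRev_nil : cylRev [] = Set.univ := by
  ext s; simp [cylRev]

lemma mem_cylRev_cons (b : Bool) (u : List Bool) (s : L) :
    s ∈ cylRev (b :: u) ↔ s 0 = b ∧ (fun n => s (n + 1)) ∈ cylRev u := by
  constructor
  · intro h
    exact ⟨h 0 (by simp), fun i hi => by simpa using h (i + 1) (by simpa using hi)⟩
  · rintro ⟨h0, h⟩ i hi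
    cases i with
    | zero => simpa using h0
    | succ i => simpa using h i (by simpa using hi)

@[simp] lemma extend_mem_cylRev_cons (b c : Bool) (u : List Bool) (s : L) :
    extend c s ∈ cylRev (b :: u) ↔ c = b ∧ s ∈ cylRev u := by
  rw [mem_cylRev_cons]; rfl

lemma measurableSet_cylRev (u : List Bool) : MeasurableSet (cylRev u) := by
  have : cylRev u = ⋂ i ∈ Finset.range u.length, (fun s : L => s i) ⁻¹' {u.getD i false} := by
    ext s; simp [cylRev]
  rw [this]
  exact Finset.measurableSet_biInter _ fun i _ =>
    measurable_pi_apply i (measurableSet_singleton _)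

lemma mem_cylRev_map_range (s : L) (n : ℕ) : s ∈ cylRev ((List.range n).map s) := by
  intro i hi
  have hi' : i < n := by simpa using hi
  simp [List.getD_eq_getElem?_getD, hi']

lemma cylRev_inter_subset {u v : List Bool} (h : u.length ≤ v.length)
    (hne : (cylRev u ∩ cylRev v).Nonempty) : cylRev v ⊆ cylRev u := by
  obtain ⟨t, htu, htv⟩ := hne
  intro s hs i hi
  rw [← htu i hi, hs i (hi.trans_le h), htv i (hi.trans_le h)]

lemma isPiSystem_cylRev : IsPiSystem (Set.range cylRev) := by
  rintro _ ⟨u, rfl⟩ _ ⟨v, rfl⟩ hne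
  rcases le_total u.length v.length with h | h
  · exact ⟨v, (Set.inter_eq_right.2 (cylRev_inter_subset h hne)).symm⟩
  · exact ⟨u, (Set.inter_eq_left.2 (cylRev_inter_subset h (by rwa [Set.inter_comm]))).symm⟩

lemma generateFrom_cylRev :
    (MeasurableSpace.pi : MeasurableSpace L) = MeasurableSpace.generateFrom (Set.range cylRev) := by
  apply le_antisymm
  · refine iSup_le fun i => ?_
    rintro _ ⟨t, -, rfl⟩
    have : (fun s : L => s i) ⁻¹' t
        = ⋃ u ∈ {u : List Bool | i < u.length ∧ u.getD i false ∈ t}, cylRev u := by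
      ext s
      simp only [Set.mem_preimage, Set.mem_ofPred_eq, Set.mem_iUnion]
      constructor
      · intro hs
        refine ⟨(List.range (i + 1)).map s, ⟨by simp, ?_⟩, mem_cylRev_map_range s _⟩
        rwa [← mem_cylRev_map_range s (i + 1) i (by simp)]
      · rintro ⟨u, ⟨hi, hu⟩, hs⟩
        rwa [hs i hi]
    rw [this]
    exact MeasurableSet.biUnion (Set.to_countable _) fun u _ =>
      MeasurableSpace.measurableSet_generateFrom ⟨u, rfl⟩
  · apply MeasurableSpace.generateFrom_le
    rintro _ ⟨u, rfl⟩
    exact measurableSet_cylRev u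

lemma measure_ext_cylRev {π ρ : Measure L} [IsFiniteMeasure π]
    (h : ∀ u, π (cylRev u) = ρ (cylRev u)) : π = ρ := by
  refine ext_of_generate_finite _ generateFrom_cylRev isPiSystem_cylRev ?_ ?_
  · rintro _ ⟨u, rfl⟩
    exact h u
  · simpa [cylRev_nil] using h []

lemma mem_cylRev_replicate (n : ℕ) (s : L) :
    s ∈ cylRev (List.replicate n false) ↔ ∀ i < n, s i = false := by
  simp +contextual [cylRev, List.getD_eq_getElem?_getD]

lemma mem_cylRev_replicate_append (n : ℕ) (s : L) :
    s ∈ cylRev (List.replicate n false ++ [true]) ↔ (∀ i < n, s i = false) ∧ s n = true := by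
  constructor
  · intro h
    refine ⟨fun i hi => ?_, ?_⟩
    · simpa [List.getD_eq_getElem?_getD, List.getElem?_append, hi] using h i (by simp; omega)
    · simpa [List.getD_eq_getElem?_getD, List.getElem?_append] using h n (by simp)
  · rintro ⟨h0, h1⟩ i hi
    have hi' : i < n ∨ i = n := by simp at hi; omega
    rcases hi' with hi' | rfl
    · simpa [List.getD_eq_getElem?_getD, List.getElem?_append, hi'] using h0 i hi'
    · simpa [List.getD_eq_getElem?_getD, List.getElem?_append] using h1

lemma exists_context (s : L) (hs : s ≠ zeroSeq) :
    ∃ n, s ∈ cylRev (List.replicate n false ++ [true]) := by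
  have h : ∃ n, s n = true := by
    by_contra! h
    exact hs (funext fun n => by simpa [zeroSeq] using h n)
  refine ⟨Nat.find h, (mem_cylRev_replicate_append _ _).2 ⟨fun i hi => ?_, Nat.find_spec h⟩⟩
  simpa using Nat.find_min h hi

lemma mem_context_of_mem_cylRev (u : List Bool) (hu : true ∈ u) (s : L) (hs : s ∈ cylRev u) :
    s ∈ cylRev (List.replicate (u.takeWhile (fun x => !x)).length false ++ [true]) := by
  induction u generalizing s with
  | nil => simp at hu
  | cons b u ih =>
    rw [mem_cylRev_cons] at hs
    cases b with
    | true => simp [mem_cylRev_cons, cylRev_nil, hs.1]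
    | false =>
      have := ih (by simpa using hu) _ hs.2
      simpa [List.replicate_succ, mem_cylRev_cons, hs.1] using this

lemma pairwise_disjoint_context :
    Pairwise (Function.onFun Disjoint fun n => cylRev (List.replicate n false ++ [true])) := by
  intro m n hmn
  rw [Function.onFun, Set.disjoint_left]
  intro s hm hn
  rw [mem_cylRev_replicate_append] at hm hn
  rcases hmn.lt_or_gt with h | h
  · simpa [hm.2] using hn.1 m h
  · simpa [hn.2] using hm.1 n h

lemma iUnion_context :
    ⋃ n, cylRev (List.replicate n false ++ [true]) = {zeroSeq}ᶜ := by
  ext s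
  simp only [Set.mem_iUnion, Set.mem_compl_iff, Set.mem_singleton_iff]
  refine ⟨?_, exists_context s⟩
  rintro ⟨n, hn⟩ rfl
  simpa [zeroSeq] using ((mem_cylRev_replicate_append _ _).1 hn).2

lemma eq_replicate_of_true_notMem {u : List Bool} (hu : true ∉ u) :
    u = List.replicate u.length false :=
  List.eq_replicate_iff.2 ⟨rfl, fun b hb => by
    cases b with
    | false => rfl
    | true => exact absurd hb hu⟩

end Cylinders

section Stationary

variable {q : ℕ → Bool → ℝ≥0∞} {qinf : Bool → ℝ≥0∞} {κ : Kernel L L}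

lemma exists_letter_law (hq : ∀ n, q n false + q n true = 1)
    (hqinf : qinf false + qinf true = 1) (hκ : IsCombKernel q qinf κ) (s : L) :
    ∃ p : Bool → ℝ≥0∞, p false + p true = 1 ∧
      κ s = p false • Measure.dirac (extend false s) + p true • Measure.dirac (extend true s) := by
  by_cases hs : s = zeroSeq
  · subst hs
    exact ⟨qinf, hqinf, hκ.2⟩
  · obtain ⟨n, hn⟩ := exists_context s hs
    exact ⟨q n, hq n, hκ.1 n s hn⟩

lemma measure_cylRev_cons_add {π : Measure L} (hq : ∀ n, q n false + q n true = 1)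
    (hqinf : qinf false + qinf true = 1) (hκ : IsCombKernel q qinf κ) (hπ : IsStationary κ π)
    (u : List Bool) :
    π (cylRev (false :: u)) + π (cylRev (true :: u)) = π (cylRev u) := by
  rw [hπ _ (measurableSet_cylRev _), hπ _ (measurableSet_cylRev (true :: u)),
    ← lintegral_add_left (κ.measurable_coe (measurableSet_cylRev _)),
    ← lintegral_indicator_one (measurableSet_cylRev u)]
  refine lintegral_congr fun s => ?_
  obtain ⟨p, hp, hs⟩ := exists_letter_law hq hqinf hκ s
  by_cases h : s ∈ cylRev u <;>
    simp [hs, h, hp, Measure.dirac_apply' _ (measurableSet_cylRev _), Set.indicator]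

lemma measure_cylRev_cons_of_mem {π : Measure L} (hq : ∀ n, q n false + q n true = 1)
    (hqinf : qinf false + qinf true = 1) (hκ : IsCombKernel q qinf κ) (hπ : IsStationary κ π)
    (u : List Bool) (hu : true ∈ u) (b : Bool) :
    π (cylRev (b :: u)) = π (cylRev u) * q (u.takeWhile (fun x => !x)).length b := by
  rw [hπ _ (measurableSet_cylRev _), mul_comm,
    ← lintegral_indicator_const (measurableSet_cylRev u)]
  refine lintegral_congr fun s => ?_
  by_cases h : s ∈ cylRev u
  · rw [hκ.1 _ s (mem_context_of_mem_cylRev u hu s h)]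
    cases b <;> simp [h, Measure.dirac_apply' _ (measurableSet_cylRev _), Set.indicator]
  · obtain ⟨p, -, hs⟩ := exists_letter_law hq hqinf hκ s
    simp [hs, h, Measure.dirac_apply' _ (measurableSet_cylRev _), Set.indicator]

lemma length_takeWhile_replicate_append (n : ℕ) :
    ((List.replicate n false ++ [true]).takeWhile (fun x => !x)).length = n := by
  induction n with
  | zero => simp
  | succ n => simp [List.replicate_succ]

lemma measure_context {π : Measure L} (hq : ∀ n, q n false + q n true = 1)
    (hqinf : qinf false + qinf true = 1) (hκ : IsCombKernel q qinf κ) (hπ : IsStationary κ π)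
    (n : ℕ) :
    π (cylRev (List.replicate n false ++ [true])) = π (cyl [true]) * combC q n := by
  induction n with
  | zero => simp [cyl, combC]
  | succ n ih =>
    rw [List.replicate_succ, List.cons_append,
      measure_cylRev_cons_of_mem hq hqinf hκ hπ _ (by simp), ih, length_takeWhile_replicate_append,
      combC, combC, Finset.prod_range_succ, mul_assoc]

lemma measure_true_mul_tsum {π : Measure L} [IsProbabilityMeasure π]
    (hq : ∀ n, q n false + q n true = 1)
    (hqinf : qinf false + qinf true = 1) (hκ : IsCombKernel q qinf κ) (hπ : IsStationary κ π) :
    π (cyl [true]) * (∑' n, combC q n) + π {zeroSeq} = 1 := by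
  rw [← ENNReal.tsum_mul_left, ← prob_add_prob_compl (μ := π) (measurableSet_singleton zeroSeq),
    ← iUnion_context, measure_iUnion pairwise_disjoint_context fun n => measurableSet_cylRev _,
    add_comm]
  simp_rw [measure_context hq hqinf hκ hπ]

lemma measure_zeros {π : Measure L} [IsProbabilityMeasure π]
    (hq : ∀ n, q n false + q n true = 1)
    (hqinf : qinf false + qinf true = 1) (hκ : IsCombKernel q qinf κ) (hπ : IsStationary κ π)
    (n : ℕ) :
    π (cylRev (List.replicate n false)) + π (cyl [true]) * ∑ k ∈ Finset.range n, combC q k = 1 := by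
  induction n with
  | zero => simp [cylRev_nil]
  | succ n ih =>
    have hsplit : cylRev (List.replicate n false)
        = cylRev (List.replicate (n + 1) false) ∪ cylRev (List.replicate n false ++ [true]) := by
      ext s
      simp only [Set.mem_union, mem_cylRev_replicate, mem_cylRev_replicate_append]
      constructor
      · intro h
        cases hs : s n with
        | true => exact Or.inr ⟨h, rfl⟩
        | false =>
          refine Or.inl fun i hi => ?_
          rcases Nat.lt_succ_iff_lt_or_eq.1 hi with hi | rfl
          exacts [h i hi, hs]
      · rintro (h | h)
        · exact fun i hi => h i (by omega)
        · exact h.1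
    have hdisj : Disjoint (cylRev (List.replicate (n + 1) false))
        (cylRev (List.replicate n false ++ [true])) := by
      rw [Set.disjoint_left]
      intro s h h'
      rw [mem_cylRev_replicate] at h
      rw [mem_cylRev_replicate_append] at h'
      simpa [h'.2] using h n (by omega)
    rw [hsplit, measure_union hdisj (measurableSet_cylRev _), measure_context hq hqinf hκ hπ] at ih
    rw [Finset.sum_range_succ, mul_add, ← ih]
    ring

lemma stationary_unique {π ρ : Measure L} [IsProbabilityMeasure π] [IsProbabilityMeasure ρ]
    (hq : ∀ n, q n false + q n true = 1)
    (hqinf : qinf false + qinf true = 1) (hκ : IsCombKernel q qinf κ)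
    (hconv : (∑' n, combC q n) ≠ ∞) (hπ : IsStationary κ π) (hρ : IsStationary κ ρ)
    (h : π {zeroSeq} = ρ {zeroSeq}) : π = ρ := by
  have hS : (∑' n, combC q n) ≠ 0 := by
    intro h0
    simpa [combC] using ENNReal.tsum_eq_zero.1 h0 0
  have h1 : π (cyl [true]) = ρ (cyl [true]) := by
    have := (measure_true_mul_tsum hq hqinf hκ hπ).trans (measure_true_mul_tsum hq hqinf hκ hρ).symm
    rw [h, ENNReal.add_left_inj (measure_ne_top _ _)] at this
    exact (ENNReal.mul_left_inj hS hconv).1 this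
  have hz (n : ℕ) :
      π (cylRev (List.replicate n false)) = ρ (cylRev (List.replicate n false)) := by
    have := (measure_zeros hq hqinf hκ hπ n).trans (measure_zeros hq hqinf hκ hρ n).symm
    rw [h1] at this
    have hne : ρ (cyl [true]) * ∑ k ∈ Finset.range n, combC q k ≠ ∞ :=
      ne_top_of_le_ne_top ENNReal.one_ne_top
        (le_add_self.trans_eq (measure_zeros hq hqinf hκ hρ n))
    exact (ENNReal.add_left_inj hne).1 this
  refine measure_ext_cylRev fun u => ?_
  induction u with
  | nil => simp [cylRev_nil]
  | cons b u ih =>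
    by_cases hu : true ∈ u
    · rw [measure_cylRev_cons_of_mem hq hqinf hκ hπ u hu,
        measure_cylRev_cons_of_mem hq hqinf hκ hρ u hu, ih]
    · have hf : π (cylRev (false :: u)) = ρ (cylRev (false :: u)) := by
        rw [eq_replicate_of_true_notMem hu, ← List.replicate_succ]
        exact hz _
      cases b with
      | false => exact hf
      | true =>
        have := (measure_cylRev_cons_add hq hqinf hκ hπ u).trans
          (ih.trans (measure_cylRev_cons_add hq hqinf hκ hρ u).symm)
        rw [hf] at this
        exact (ENNReal.add_right_inj (measure_ne_top _ _)).1 this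

lemma measure_cyl_append {π : Measure L} [IsProbabilityMeasure π]
    (hq : ∀ n, q n false + q n true = 1)
    (hqinf : qinf false + qinf true = 1) (hκ : IsCombKernel q qinf κ) (hπ : IsStationary κ π)
    (w : List Bool) (b : Bool) :
    π (cyl (w ++ [b])) = π (cyl w) * combQstep q π w b := by
  have hcyl : cyl (w ++ [b]) = cylRev (b :: w.reverse) := by simp [cyl]
  unfold combQstep
  split_ifs with h h0
  · have hle : π (cyl (w ++ [b])) ≤ π (cyl w) := by
      rw [hcyl, cyl, ← measure_cylRev_cons_add hq hqinf hκ hπ w.reverse]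
      cases b
      exacts [le_self_add, le_add_self]
    rw [h0] at hle ⊢
    simpa using hle
  · rw [ENNReal.mul_div_cancel h0 (measure_ne_top _ _)]
  · rw [hcyl, cyl]
    refine measure_cylRev_cons_of_mem hq hqinf hκ hπ _ ?_ b
    simpa using h

lemma measure_cyl_eq_prod {π : Measure L} [IsProbabilityMeasure π]
    (hq : ∀ n, q n false + q n true = 1)
    (hqinf : qinf false + qinf true = 1) (hκ : IsCombKernel q qinf κ) (hπ : IsStationary κ π)
    (w : List Bool) :
    π (cyl w) = ∏ k ∈ Finset.range w.length, combQstep q π (w.take k) (w.getD k false) := by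
  induction w using List.reverseRecOn with
  | nil => simp [cyl, cylRev_nil]
  | append_singleton w b ih =>
    rw [measure_cyl_append hq hqinf hκ hπ, ih, List.length_append, List.length_singleton,
      Finset.prod_range_succ]
    congr 1
    · refine Finset.prod_congr rfl fun k hk => ?_
      rw [Finset.mem_range] at hk
      rw [List.take_append_of_le_length hk.le, List.getD_append _ _ _ _ hk]
    · simp [List.getD_eq_getElem?_getD]

lemma eq_dirac_of_measure_singleton {π : Measure L} [IsProbabilityMeasure π] {s : L}
    (h : π {s} = 1) : π = Measure.dirac s := by
  rw [← Measure.restrict_eq_self_of_ae_mem (s := {s}) (μ := π), Measure.restrict_singleton, h,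
    one_smul]
  exact (prob_compl_eq_zero_iff (measurableSet_singleton s)).2 h

lemma isStationary_dirac {s : L} (h : κ s = Measure.dirac s) :
    IsStationary κ (Measure.dirac s) := by
  intro B hB
  rw [lintegral_dirac' _ (κ.measurable_coe hB), h]

lemma kernel_constTrue (hq : ∀ n, q n false + q n true = 1) (hκ : IsCombKernel q qinf κ)
    (h0 : q 0 false = 0) : κ (fun _ => true) = Measure.dirac fun _ => true := by
  have h1 : q 0 true = 1 := by simpa [h0] using hq 0
  rw [hκ.1 0 (fun _ => true) (by simp [mem_cylRev_cons, cylRev_nil]), h0, h1, zero_smul, zero_add,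
    one_smul]
  congr 1
  funext n
  cases n <;> rfl

lemma kernel_zeroSeq (hqinf : qinf false + qinf true = 1) (hred : qinf false = 1)
    (hκ : IsCombKernel q qinf κ) : κ zeroSeq = Measure.dirac zeroSeq := by
  have h1 : qinf true = 0 := by
    rw [hred] at hqinf
    exact (ENNReal.add_right_inj ENNReal.one_ne_top).1 (hqinf.trans (add_zero 1).symm)
  rw [hκ.2, hred, h1, zero_smul, add_zero, one_smul]
  congr 1
  funext n
  cases n <;> rfl

lemma q_zero_false_of_stationary_dirac {s : L} (hκ : IsCombKernel q qinf κ)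
    (hq : ∀ n, q n false + q n true = 1) (hs : s ≠ zeroSeq)
    (hπ : IsStationary κ (Measure.dirac s)) : q 0 false = 0 := by
  obtain ⟨n, hn⟩ := exists_context s hs
  have hκs : κ s {s} = 1 := by
    have := hπ {s} (measurableSet_singleton s)
    rw [lintegral_dirac' _ (κ.measurable_coe (measurableSet_singleton s))] at this
    simpa using this.symm
  have hext (b : Bool) (h : extend b s = s) (k : ℕ) : s k = b := by
    induction k with
    | zero => rw [← h]; rfl
    | succ k ih => rw [← h]; exact ih
  have hf : extend false s ≠ s := fun h => hs (funext (hext false h))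
  have ht : extend true s = s := by
    by_contra ht
    rw [hκ.1 n s hn] at hκs
    simp [hf, ht] at hκs
  have hs0 : s ∈ cylRev (List.replicate 0 false ++ [true]) := by
    simpa [mem_cylRev_cons, cylRev_nil] using hext true ht 0
  rw [hκ.1 0 s hs0] at hκs
  have h1 : q 0 true = 1 := by simpa [hf, ht] using hκs
  have := hq 0
  rw [h1] at this
  exact (ENNReal.add_left_inj ENNReal.one_ne_top).1 (this.trans (zero_add 1).symm)

lemma eq_dirac_constTrue {π : Measure L} [IsProbabilityMeasure π]
    (hq : ∀ n, q n false + q n true = 1)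
    (hqinf : qinf false + qinf true = 1) (hκ : IsCombKernel q qinf κ)
    (hconv : (∑' n, combC q n) ≠ ∞) (hs : IsStationary κ π) (hπ : π {zeroSeq} = 0)
    (h0 : q 0 false = 0) : π = Measure.dirac fun _ => true := by
  refine stationary_unique hq hqinf hκ hconv hs (isStationary_dirac (kernel_constTrue hq hκ h0)) ?_
  have : (fun _ => true : L) ≠ zeroSeq := fun h => by simpa [zeroSeq] using congrFun h 0
  simp [hπ, this]

end Stationary

section Existence

/-- Prepend an integer to a sequence of integers. -/
def consSeq (n : ℕ) (g : ℕ → ℕ) : ℕ → ℕ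
  | 0 => n
  | k + 1 => g k

/-- The left-infinite sequence `⋯ 1 0^{g 1} 1 0^{g 0} 1 0ⁿ`. -/
def ofGaps : ℕ → (ℕ → ℕ) → L
  | 0, _, 0 => true
  | 0, g, k + 1 => ofGaps (g 0) (fun i => g (i + 1)) k
  | _ + 1, _, 0 => false
  | n + 1, g, k + 1 => ofGaps n g k

lemma extend_false_ofGaps (n : ℕ) (g : ℕ → ℕ) : extend false (ofGaps n g) = ofGaps (n + 1) g := by
  funext k
  cases k <;> simp [extend, ofGaps]

lemma extend_true_ofGaps (n : ℕ) (g : ℕ → ℕ) :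
    extend true (ofGaps n g) = ofGaps 0 (consSeq n g) := by
  funext k
  cases k <;> simp [extend, ofGaps, consSeq]

lemma ofGaps_mem_context (n : ℕ) (g : ℕ → ℕ) :
    ofGaps n g ∈ cylRev (List.replicate n false ++ [true]) := by
  induction n with
  | zero => simp [mem_cylRev_cons, cylRev_nil, ofGaps]
  | succ n ih => simpa [← extend_false_ofGaps, List.replicate_succ] using ih

lemma measurable_consSeq (n : ℕ) : Measurable (consSeq n) := by
  refine measurable_pi_iff.2 fun k => ?_
  cases k with
  | zero => exact measurable_const
  | succ k => exact measurable_pi_apply k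

lemma measurable_ofGaps (n : ℕ) : Measurable (ofGaps n) := by
  refine measurable_pi_iff.2 fun k => ?_
  induction k generalizing n with
  | zero => cases n <;> simp [ofGaps]
  | succ k ih =>
    cases n with
    | zero =>
      simp only [ofGaps]
      have h : Measurable fun p : ℕ × (ℕ → ℕ) => ofGaps p.1 p.2 k :=
        measurable_from_prod_countable_right fun n => ih n
      have hs : Measurable fun g : ℕ → ℕ => (g 0, fun i => g (i + 1)) := by fun_prop
      exact h.comp hs
    | succ n => simpa [ofGaps] using ih n

lemma sum_map_consSeq_infinitePi (μ : Measure ℕ) [IsProbabilityMeasure μ] :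
    Measure.sum (fun n => μ {n} • (Measure.infinitePi fun _ : ℕ => μ).map (consSeq n))
      = Measure.infinitePi fun _ : ℕ => μ := by
  refine Measure.eq_infinitePi _ fun s t _ => ?_
  obtain ⟨N, hN⟩ := s.exists_nat_subset_range
  set t' : ℕ → Set ℕ := fun i => if i ∈ s then t i else Set.univ with ht'
  have hprod : ∏ i ∈ s, μ (t i) = ∏ i ∈ Finset.range (N + 1), μ (t' i) := by
    rw [← Finset.prod_subset (hN.trans (Finset.range_mono N.le_succ))
      (fun i _ hi => by simp [ht', hi])]
    exact Finset.prod_congr rfl fun i hi => by simp [ht', hi]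
  have hpre (n : ℕ) : consSeq n ⁻¹' Set.pi s t
      = {_g | n ∈ t' 0} ∩ Set.pi (Finset.range N) fun i => t' (i + 1) := by
    ext g
    simp only [Set.mem_preimage, Set.mem_pi, Set.mem_inter_iff, Set.mem_ofPred_eq, ht',
      SetLike.mem_coe, Finset.mem_range]
    constructor
    · intro h
      refine ⟨?_, fun i _ => ?_⟩
      · split_ifs with h0
        exacts [h 0 h0, trivial]
      · split_ifs with hi
        exacts [h _ hi, trivial]
    · rintro ⟨h0, h⟩ i hi
      cases i with
      | zero => simpa [hi, consSeq] using h0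
      | succ i =>
        have := Finset.mem_range.1 (hN hi)
        simpa [hi, consSeq] using h i (by omega)
  have hms : MeasurableSet (Set.pi (s : Set ℕ) t) :=
    MeasurableSet.pi s.countable_toSet fun i _ => MeasurableSet.of_discrete
  rw [hprod, Measure.sum_apply _ hms, Finset.prod_range_succ', mul_comm]
  conv_rhs => rw [← Measure.sum_smul_dirac μ, Measure.sum_apply _ MeasurableSet.of_discrete,
    Measure.sum_smul_dirac μ, ← ENNReal.tsum_mul_right]
  refine tsum_congr fun n => ?_
  rw [Measure.smul_apply, Measure.map_apply (measurable_consSeq n) hms, hpre]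
  by_cases hn : n ∈ t' 0
  · have := Measure.infinitePi_pi (fun _ : ℕ => μ) (s := Finset.range N)
      (t := fun i => t' (i + 1)) fun _ _ => MeasurableSet.of_discrete
    simp only [hn, Set.ofPred_true, Set.univ_inter, this]
    simp [hn]
  · simp [hn]

variable {q : ℕ → Bool → ℝ≥0∞} {qinf : Bool → ℝ≥0∞} {κ : Kernel L L}

lemma tsum_gap (hq : ∀ n, q n false + q n true = 1) (hconv : (∑' n, combC q n) ≠ ∞) :
    ∑' n, combC q n * q n true = 1 := by
  have hsplit : ∑' n, combC q n = 1 + ∑' n, combC q (n + 1) := by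
    rw [tsum_eq_zero_add' ENNReal.summable]
    simp [combC]
  have hne : (∑' n, combC q (n + 1)) ≠ ∞ := fun h => hconv (by rw [hsplit, h, add_top])
  refine (ENNReal.add_left_inj hne).1 (Eq.trans ?_ hsplit)
  rw [← ENNReal.tsum_add]
  refine tsum_congr fun n => ?_
  rw [combC, combC, Finset.prod_range_succ, ← mul_add, add_comm (q n true), hq, mul_one]

/-- The stationary measure without mass at `zeroSeq`, built from independent gaps. -/
noncomputable def renewalMeasure (q : ℕ → Bool → ℝ≥0∞) (μ : Measure ℕ) : Measure L :=
  Measure.sum fun n => ((∑' k, combC q k)⁻¹ * combC q n) •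
    (Measure.infinitePi fun _ : ℕ => μ).map (ofGaps n)

lemma renewalMeasure_apply (μ : Measure ℕ) {B : Set L} (hB : MeasurableSet B) :
    renewalMeasure q μ B = (∑' k, combC q k)⁻¹ * ∑' n, combC q n *
      (Measure.infinitePi fun _ : ℕ => μ) (ofGaps n ⁻¹' B) := by
  rw [renewalMeasure, Measure.sum_apply _ hB, ← ENNReal.tsum_mul_left]
  refine tsum_congr fun n => ?_
  rw [Measure.smul_apply, Measure.map_apply (measurable_ofGaps n) hB, smul_eq_mul, mul_assoc]

lemma isStationary_renewalMeasure (hκ : IsCombKernel q qinf κ) (μ : Measure ℕ)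
    [IsProbabilityMeasure μ] (hμ : ∀ n, μ {n} = combC q n * q n true) :
    IsStationary κ (renewalMeasure q μ) := by
  intro B hB
  set P := Measure.infinitePi fun _ : ℕ => μ with hP
  have hκB (n : ℕ) (g : ℕ → ℕ) : κ (ofGaps n g) B
      = q n false * (ofGaps (n + 1) ⁻¹' B).indicator 1 g
        + q n true * (consSeq n ⁻¹' (ofGaps 0 ⁻¹' B)).indicator 1 g := by
    rw [hκ.1 n _ (ofGaps_mem_context n g), extend_false_ofGaps, extend_true_ofGaps]
    simp [Measure.dirac_apply' _ hB, Set.indicator]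
  have hmeas (n : ℕ) : MeasurableSet (ofGaps n ⁻¹' B) := measurable_ofGaps n hB
  have hmeas' (n : ℕ) : MeasurableSet (consSeq n ⁻¹' (ofGaps 0 ⁻¹' B)) :=
    measurable_consSeq n (hmeas 0)
  have hint (n : ℕ) : ∫⁻ s, κ s B ∂(P.map (ofGaps n))
      = q n false * P (ofGaps (n + 1) ⁻¹' B)
        + q n true * P (consSeq n ⁻¹' (ofGaps 0 ⁻¹' B)) := by
    rw [lintegral_map (κ.measurable_coe hB) (measurable_ofGaps n)]
    simp_rw [hκB]
    rw [lintegral_add_left ((measurable_one.indicator (hmeas _)).const_mul _),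
      lintegral_const_mul _ (measurable_one.indicator (hmeas _)),
      lintegral_const_mul _ (measurable_one.indicator (hmeas' _)),
      lintegral_indicator_one (hmeas _), lintegral_indicator_one (hmeas' _)]
  have hcons : P (ofGaps 0 ⁻¹' B)
      = ∑' n, combC q n * q n true * P (consSeq n ⁻¹' (ofGaps 0 ⁻¹' B)) := by
    conv_lhs => rw [hP, ← sum_map_consSeq_infinitePi μ, Measure.sum_apply _ (hmeas 0)]
    refine tsum_congr fun n => ?_
    rw [Measure.smul_apply, Measure.map_apply (measurable_consSeq n) (hmeas 0), hμ, smul_eq_mul]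
  rw [renewalMeasure_apply μ hB, renewalMeasure, lintegral_sum_measure]
  simp_rw [lintegral_smul_measure, ← hP, hint, smul_eq_mul, mul_assoc]
  rw [ENNReal.tsum_mul_left,
    tsum_eq_zero_add' (f := fun n => combC q n * P (ofGaps n ⁻¹' B)) ENNReal.summable, hcons]
  simp_rw [mul_add]
  rw [ENNReal.tsum_add, mul_add, add_comm]
  congr 2
  · refine tsum_congr fun n => ?_
    rw [combC, combC, Finset.prod_range_succ, mul_assoc]
  · simp [combC, mul_assoc]

lemma exists_stationary_zero (hq : ∀ n, q n false + q n true = 1)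
    (hκ : IsCombKernel q qinf κ) (hconv : (∑' n, combC q n) ≠ ∞) :
    ∃ π : Measure L, IsProbabilityMeasure π ∧ IsStationary κ π ∧ π {zeroSeq} = 0 := by
  have hS : (∑' n, combC q n) ≠ 0 := by
    intro h0
    simpa [combC] using ENNReal.tsum_eq_zero.1 h0 0
  set μ : Measure ℕ := Measure.sum fun n => (combC q n * q n true) • Measure.dirac n with hμdef
  have hμ (n : ℕ) : μ {n} = combC q n * q n true := by
    rw [hμdef, Measure.sum_apply _ (measurableSet_singleton n), tsum_eq_single n]
    · simp
    · intro m hm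
      simp [hm]
  have : IsProbabilityMeasure μ := ⟨by
    rw [hμdef, Measure.sum_apply _ MeasurableSet.univ]
    simpa using tsum_gap hq hconv⟩
  refine ⟨renewalMeasure q μ, ⟨?_⟩, isStationary_renewalMeasure hκ μ hμ, ?_⟩
  · rw [renewalMeasure_apply μ MeasurableSet.univ]
    simpa using ENNReal.inv_mul_cancel hS hconv
  · rw [renewalMeasure_apply μ (measurableSet_singleton _)]
    have (n : ℕ) : ofGaps n ⁻¹' {zeroSeq} = ∅ := by
      ext g
      simp only [Set.mem_preimage, Set.mem_singleton_iff, Set.mem_empty_iff_false, iff_false]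
      intro h
      have := ((mem_cylRev_replicate_append _ _).1 (ofGaps_mem_context n g)).2
      simp [h, zeroSeq] at this
    simp [this]

lemma IsStationary.add_smul {π ρ : Measure L} (hπ : IsStationary κ π) (hρ : IsStationary κ ρ)
    (a b : ℝ≥0∞) : IsStationary κ (a • π + b • ρ) := by
  intro B hB
  simp [lintegral_add_measure, lintegral_smul_measure, hπ B hB, hρ B hB]

lemma exists_stationary (hq : ∀ n, q n false + q n true = 1)
    (hqinf : qinf false + qinf true = 1) (hred : qinf false = 1)
    (hκ : IsCombKernel q qinf κ) (hconv : (∑' n, combC q n) ≠ ∞) (a : ℝ≥0∞) (ha : a ≤ 1) :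
    ∃ π : Measure L, IsProbabilityMeasure π ∧ IsStationary κ π ∧ π {zeroSeq} = a := by
  obtain ⟨ρ, hρ, hρs, hρ0⟩ := exists_stationary_zero hq hκ hconv
  refine ⟨a • Measure.dirac zeroSeq + (1 - a) • ρ, ⟨?_⟩,
    (isStationary_dirac (kernel_zeroSeq hqinf hred hκ)).add_smul hρs _ _, ?_⟩
  · simpa using add_tsub_cancel_of_le ha
  · simp [hρ0]

end Existence

/-- (Infinite comb, reducible case, convergent series.)
If `q_{0^∞}(0) = 1` and the series `∑ cₙ` converges, with sum `S(1)`, there is a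
one-parameter family of stationary probability measures : for every `a ∈ [0,1]`
there is a unique stationary probability measure `π_a` with `π_a(0^∞) = a`,
characterized by `π_a(1) = (1-a)/S(1)`, `π_a(10ⁿ) = π_a(1)cₙ`,
`π_a(0ⁿ) = 1 - π_a(1)∑_{k<n}cₖ` and the product formula. Moreover `π_a` is
trivial exactly when `a = 1` (then `π₁ = δ_{0^∞}`) or when `a = 0` and
`q₁(0) = 0` (then `π₀ = δ_{1^∞}`). -/
theorem comb_reducible_convergent
    (q : ℕ → Bool → ℝ≥0∞) (qinf : Bool → ℝ≥0∞)
    (hq : ∀ n, q n false + q n true = 1) (hqinf : qinf false + qinf true = 1)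
    (hred : qinf false = 1)
    (hconv : (∑' n, combC q n) ≠ ∞)
    (κ : Kernel L L) [IsMarkovKernel κ] (hκ : IsCombKernel q qinf κ)
    (a : ℝ≥0∞) (ha : a ≤ 1) :
    (∃! π : Measure L, IsProbabilityMeasure π ∧ IsStationary κ π ∧ π {zeroSeq} = a) ∧
    ∀ π : Measure L, IsProbabilityMeasure π → IsStationary κ π → π {zeroSeq} = a →
      (π (cyl [true]) * (∑' n, combC q n) + a = 1 ∧
       (∀ n, π (cylRev (List.replicate n false ++ [true]))
          = π (cyl [true]) * combC q n) ∧
       (∀ n, π (cylRev (List.replicate n false))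
          + π (cyl [true]) * ∑ k ∈ Finset.range n, combC q k = 1) ∧
       (∀ w : List Bool,
          π (cyl w) = ∏ k ∈ Finset.range w.length, combQstep q π (w.take k) (w.getD k false)) ∧
       ((∃ s : L, π {s} = 1) ↔ (a = 1 ∨ (a = 0 ∧ q 0 false = 0))) ∧
       (a = 1 → π = Measure.dirac zeroSeq) ∧
       (a = 0 → q 0 false = 0 → π = Measure.dirac (fun _ => true))) := by
  refine ⟨?_, fun π hπ hs hπa => ⟨?_, measure_context hq hqinf hκ hs,
    measure_zeros hq hqinf hκ hs, measure_cyl_eq_prod hq hqinf hκ hs, ?_, ?_, ?_⟩⟩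
  · obtain ⟨π, hπ, hs, hπa⟩ := exists_stationary hq hqinf hred hκ hconv a ha
    refine ⟨π, ⟨hπ, hs, hπa⟩, ?_⟩
    rintro ρ ⟨hρ, hρs, hρa⟩
    exact stationary_unique hq hqinf hκ hconv hρs hs (hρa.trans hπa.symm)
  · rw [← hπa]
    exact measure_true_mul_tsum hq hqinf hκ hs
  · constructor
    · rintro ⟨s, h1⟩
      have hd := eq_dirac_of_measure_singleton h1
      by_cases hz : s = zeroSeq
      · exact Or.inl (by rw [← hπa, ← hz, h1])
      · refine Or.inr ⟨by simp [← hπa, hd, hz], ?_⟩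
        rw [hd] at hs
        exact q_zero_false_of_stationary_dirac hκ hq hz hs
    · rintro (rfl | ⟨rfl, h0⟩)
      · exact ⟨zeroSeq, hπa⟩
      · exact ⟨fun _ => true, by rw [eq_dirac_constTrue hq hqinf hκ hconv hs hπa h0]; simp⟩
  · rintro rfl
    exact eq_dirac_of_measure_singleton hπa
  · rintro rfl h0
    exact eq_dirac_constTrue hq hqinf hκ hconv hs hπa h0

end VLMC
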